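/- Let m ≥ 1 and let p(τ,y) = Σ_{a≥0} Σ_{b=−m}^{m} α_{a,b} τ^a y^b (coefficients α_{a,b} in the ring R of formal Laurent series over ℤ) satisfy conditions (1)–(4) of the su(1|2)-expansion theorem: α_{a,b} = α_{a,−b}; α_{a,b} = 0 for a < |b|; p(τ,τ) is a constant nonnegative integer; and each α_{a,−a} (0 ≤ a ≤ m) is a nonnegative integer multiple of 1 ∈ R. Set q_a := α_{a,m}. Then q_a = 0 for a < m, q_m is a nonnegative integer multiple of 1 ∈ R, and the series p̃(τ,y) := p(τ,y) − q_m · I_{m,m}(τ,y) + Σ_{a≥m+1} q_a · I_{a−1,m−1}(τ,y) has y-degree at most m−1 (i.e. its coefficients of y^b vanish for |b| ≥ m) and again satisfies conditions (1)–(4) with m replaced by m−1. -/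

import Mathlib

open Finset

/-- Coefficient of `y^d` in the `su(2)` character `χ_n(y) = Σ_{k=0}^n y^{n-2k}`,
extended by `χ_n = 0` for `n < 0`. -/
def chiCoeff (n : ℤ) (d : ℤ) : ℤ :=
  if 0 ≤ n ∧ |d| ≤ n ∧ (n - d) % 2 = 0 then 1 else 0

/-- Coefficient of `τ^c y^d` in the 1/2-BPS character
`I_{m,m}(τ,y) = τ^m (χ_m(y) - τ χ_{m-1}(y))`. -/
def IhalfCoeff (m : ℕ) (co : ℕ) (d : ℤ) : ℤ :=
  (if co = m then chiCoeff m d else 0) - (if co = m + 1 then chiCoeff ((m : ℤ) - 1) d else 0)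

/-- Coefficient of `τ^c y^d` in the short character
`I_{m,n}(τ,y) = τ^m ((1+τ²) χ_n(y) - τ (χ_{n+1}(y) + χ_{n-1}(y)))`, for `m > n ≥ 0`. -/
def IshortCoeff (m n : ℕ) (co : ℕ) (d : ℤ) : ℤ :=
  (if co = m ∨ co = m + 2 then chiCoeff n d else 0) -
    (if co = m + 1 then chiCoeff ((n : ℤ) + 1) d + chiCoeff ((n : ℤ) - 1) d else 0)

/-- The coefficient of `τ^a y^b` in the series
`p̃(τ,y) = p(τ,y) - q_m I_{m,m}(τ,y) + Σ_{a'≥m+1} q_{a'} I_{a'-1,m-1}(τ,y)` where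
`q_{a'} = α_{a',m}`.  Since `I_{a'-1,m-1}` only involves `τ^{a'-1}, τ^{a'}, τ^{a'+1}`,
only the terms with `m+1 ≤ a' ≤ a+1` contribute to the coefficient of `τ^a`. -/
noncomputable def tildeCoeff (m : ℕ) (α : ℕ → ℤ → LaurentSeries ℤ) (a : ℕ) (b : ℤ) :
    LaurentSeries ℤ :=
  α a b - α m m * ((IhalfCoeff m a b : ℤ) : LaurentSeries ℤ) +
    ∑ a' ∈ Finset.Icc (m + 1) (a + 1),
      α a' m * ((IshortCoeff (a' - 1) (m - 1) a b : ℤ) : LaurentSeries ℤ)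

theorem chiCoeff_neg (n d : ℤ) : chiCoeff n (-d) = chiCoeff n d := by
  unfold chiCoeff
  rw [abs_neg]
  congr 1
  ext
  omega

theorem IhalfCoeff_neg (m a : ℕ) (d : ℤ) : IhalfCoeff m a (-d) = IhalfCoeff m a d := by
  simp only [IhalfCoeff, chiCoeff_neg]

theorem IshortCoeff_neg (m n a : ℕ) (d : ℤ) :
    IshortCoeff m n a (-d) = IshortCoeff m n a d := by
  simp only [IshortCoeff, chiCoeff_neg]

theorem chiCoeff_eq_zero_of_lt_abs {n d : ℤ} (h : n < |d|) : chiCoeff n d = 0 :=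
  if_neg fun h' => by omega

/-- The product rule `(y + y⁻¹) χ_n = χ_{n+1} + χ_{n-1}`. -/
theorem chiCoeff_add_chiCoeff (n : ℕ) (d : ℤ) :
    chiCoeff n (d + 1) + chiCoeff n (d - 1) = chiCoeff (n + 1) d + chiCoeff (n - 1) d := by
  simp only [chiCoeff, abs_le]
  split_ifs <;> omega

theorem IhalfCoeff_eq_zero_of_lt {m a : ℕ} (d : ℤ) (h : a < m) : IhalfCoeff m a d = 0 := by
  simp [IhalfCoeff, show a ≠ m by omega, show a ≠ m + 1 by omega]

theorem IshortCoeff_eq_zero_of_lt {m n a : ℕ} (d : ℤ) (h : a < m) :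
    IshortCoeff m n a d = 0 := by
  simp [IshortCoeff, show a ≠ m by omega, show a ≠ m + 1 by omega, show a ≠ m + 2 by omega]

theorem IhalfCoeff_eq_zero_of_lt_abs {m : ℕ} (a : ℕ) {d : ℤ} (h : (m : ℤ) < |d|) :
    IhalfCoeff m a d = 0 := by
  simp [IhalfCoeff, chiCoeff_eq_zero_of_lt_abs h,
    chiCoeff_eq_zero_of_lt_abs (show (m : ℤ) - 1 < |d| by omega)]

theorem IshortCoeff_eq_zero_of_lt_abs {n : ℕ} (m a : ℕ) {d : ℤ} (h : (n : ℤ) + 1 < |d|) :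
    IshortCoeff m n a d = 0 := by
  simp [IshortCoeff, chiCoeff_eq_zero_of_lt_abs h,
    chiCoeff_eq_zero_of_lt_abs (show (n : ℤ) < |d| by omega),
    chiCoeff_eq_zero_of_lt_abs (show (n : ℤ) - 1 < |d| by omega)]

/-- The top coefficient of `I_{m,m}` in `y`. -/
theorem IhalfCoeff_self (m a : ℕ) : IhalfCoeff m a m = if a = m then 1 else 0 := by
  simp [IhalfCoeff, chiCoeff]

/-- The top coefficient of `I_{m,n}` in `y`. -/
theorem IshortCoeff_succ (m n a : ℕ) :
    IshortCoeff m n a ((n + 1 : ℕ) : ℤ) = if a = m + 1 then -1 else 0 := by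
  have h : |(n : ℤ) + 1| = n + 1 := abs_of_nonneg (by omega)
  simp only [IshortCoeff, chiCoeff, Nat.cast_add, Nat.cast_one, h]
  split_ifs <;> omega

/-- The coefficient of `τ^c` in `I_{m,m}(τ,τ) = 1` vanishes for `c ≥ 1`. -/
theorem sum_IhalfCoeff_diagonal (m : ℕ) {c : ℤ} (hc : 1 ≤ c) :
    (∑ b ∈ Finset.Icc (-(m : ℤ)) (m : ℤ),
      if 0 ≤ c - b then IhalfCoeff m (c - b).toNat b else 0) = 0 := by
  have h (b : ℤ) : (if 0 ≤ c - b then IhalfCoeff m (c - b).toNat b else 0) =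
      (if b = c - m then chiCoeff m b else 0) -
        (if b = c - m - 1 then chiCoeff (m - 1) b else 0) := by
    unfold IhalfCoeff
    split_ifs <;> omega
  simp only [h, Finset.sum_sub_distrib, Finset.sum_ite_eq', Finset.mem_Icc, chiCoeff, abs_le]
  split_ifs <;> omega

/-- The coefficient of `τ^c` in `I_{m,n}(τ,τ) = 0` vanishes. -/
theorem sum_IshortCoeff_diagonal (m n : ℕ) (c : ℤ) :
    (∑ b ∈ Finset.Icc (-((n + 1 : ℕ) : ℤ)) ((n + 1 : ℕ) : ℤ),
      if 0 ≤ c - b then IshortCoeff m n (c - b).toNat b else 0) = 0 := by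
  have h (b : ℤ) : (if 0 ≤ c - b then IshortCoeff m n (c - b).toNat b else 0) =
      (if b = c - m then chiCoeff n b else 0) + (if b = c - m - 2 then chiCoeff n b else 0) -
        (if b = c - m - 1 then chiCoeff (n + 1) b + chiCoeff (n - 1) b else 0) := by
    unfold IshortCoeff
    split_ifs <;> omega
  have hχ {k d : ℤ} (hk : k ≤ n + 1) :
      (if -((n + 1 : ℕ) : ℤ) ≤ d ∧ d ≤ ((n + 1 : ℕ) : ℤ) then chiCoeff k d else 0) =
        chiCoeff k d := by
    simp only [chiCoeff, abs_le]
    split_ifs <;> omega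
  have hχ' {d : ℤ} : (if -((n + 1 : ℕ) : ℤ) ≤ d ∧ d ≤ ((n + 1 : ℕ) : ℤ) then
      chiCoeff (n + 1) d + chiCoeff (n - 1) d else 0) =
        chiCoeff (n + 1) d + chiCoeff (n - 1) d := by
    simp only [chiCoeff, abs_le]
    split_ifs <;> omega
  have hrec := chiCoeff_add_chiCoeff n (c - m - 1)
  rw [sub_add_cancel, sub_sub _ 1 1, one_add_one_eq_two] at hrec
  simp only [h, Finset.sum_sub_distrib, Finset.sum_add_distrib, Finset.sum_ite_eq',
    Finset.mem_Icc, hχ', hχ (show (n : ℤ) ≤ n + 1 by omega), hrec, sub_self]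

/-- A natural-number-valued family sums to a natural number. -/
theorem exists_sum_eq_natCast {ι R : Type*} [Semiring R] (s : Finset ι) (f : ι → R)
    (h : ∀ i ∈ s, ∃ n : ℕ, f i = n) : ∃ n : ℕ, ∑ i ∈ s, f i = n := by
  obtain ⟨n, hn⟩ := sum_mem (S := (Nat.castRingHom R).rangeS) fun i hi =>
    (h i hi).imp fun n hn => hn.symm
  exact ⟨n, hn.symm⟩

theorem tildeCoeff_neg {m : ℕ} {α : ℕ → ℤ → LaurentSeries ℤ}
    (hα : ∀ (a : ℕ) (b : ℤ), α a b = α a (-b)) (a : ℕ) (b : ℤ) :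
    tildeCoeff m α a b = tildeCoeff m α a (-b) := by
  simp only [tildeCoeff, IhalfCoeff_neg, IshortCoeff_neg, ← hα]

theorem tildeCoeff_of_lt {m : ℕ} (α : ℕ → ℤ → LaurentSeries ℤ) {a : ℕ} (b : ℤ) (h : a < m) :
    tildeCoeff m α a b = α a b := by
  simp [tildeCoeff, IhalfCoeff_eq_zero_of_lt b h, Finset.Icc_eq_empty_of_lt
    (show a + 1 < m + 1 by omega)]

theorem tildeCoeff_eq_zero_of_lt_abs {n a : ℕ} {α : ℕ → ℤ → LaurentSeries ℤ} {b : ℤ}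
    (hα : α a b = 0) (h : ((n + 1 : ℕ) : ℤ) < |b|) : tildeCoeff (n + 1) α a b = 0 := by
  have hs (k : ℕ) : IshortCoeff k n a b = 0 :=
    IshortCoeff_eq_zero_of_lt_abs k a (by exact_mod_cast h)
  simp [tildeCoeff, hα, IhalfCoeff_eq_zero_of_lt_abs a h, hs]

theorem tildeCoeff_self {n a : ℕ} {α : ℕ → ℤ → LaurentSeries ℤ}
    (hα : a < n + 1 → α a ((n + 1 : ℕ) : ℤ) = 0) :
    tildeCoeff (n + 1) α a ((n + 1 : ℕ) : ℤ) = 0 := by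
  rcases lt_or_ge a (n + 1) with h | h
  · rw [tildeCoeff_of_lt α _ h, hα h]
  have hsum : ∑ a' ∈ Finset.Icc (n + 1 + 1) (a + 1), α a' ((n + 1 : ℕ) : ℤ) *
      ((IshortCoeff (a' - 1) (n + 1 - 1) a ((n + 1 : ℕ) : ℤ) : ℤ) : LaurentSeries ℤ) =
      ∑ a' ∈ Finset.Icc (n + 1 + 1) (a + 1),
        if a' = a then -α a' ((n + 1 : ℕ) : ℤ) else 0 := by
    refine Finset.sum_congr rfl fun a' ha' => ?_
    rw [Finset.mem_Icc] at ha'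
    rw [Nat.add_sub_cancel, IshortCoeff_succ, Nat.sub_add_cancel (by omega)]
    by_cases haa : a' = a
    · simp [haa]
    · simp [haa, Ne.symm haa]
  rw [tildeCoeff, hsum, Finset.sum_ite_eq', IhalfCoeff_self]
  rcases h.eq_or_lt with rfl | h
  · simp
  · rw [if_neg (by omega), if_pos (Finset.mem_Icc.2 (by omega))]
    simp

/-- The inner sum in `tildeCoeff` may be extended to any larger range. -/
theorem tildeCoeff_eq_of_le (m : ℕ) (α : ℕ → ℤ → LaurentSeries ℤ) {a N : ℕ} (b : ℤ)
    (h : a + 1 ≤ N) :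
    tildeCoeff m α a b = α a b - α m m * ((IhalfCoeff m a b : ℤ) : LaurentSeries ℤ) +
      ∑ a' ∈ Finset.Icc (m + 1) N,
        α a' m * ((IshortCoeff (a' - 1) (m - 1) a b : ℤ) : LaurentSeries ℤ) := by
  rw [tildeCoeff]
  congr 1
  refine Finset.sum_subset (Finset.Icc_subset_Icc_right h) fun k hk hk' => ?_
  rw [Finset.mem_Icc] at hk hk'
  rw [IshortCoeff_eq_zero_of_lt b (by omega), Int.cast_zero, mul_zero]

/-- For `c ≥ 1` the coefficients of `τ^c` in `p̃(τ,τ)` and `p(τ,τ)` agree. -/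
theorem sum_tildeCoeff_diagonal (n : ℕ) (α : ℕ → ℤ → LaurentSeries ℤ) {c : ℤ} (hc : 1 ≤ c) :
    (∑ b ∈ Finset.Icc (-((n + 1 : ℕ) : ℤ)) ((n + 1 : ℕ) : ℤ),
      if 0 ≤ c - b then tildeCoeff (n + 1) α (c - b).toNat b else 0) =
    ∑ b ∈ Finset.Icc (-((n + 1 : ℕ) : ℤ)) ((n + 1 : ℕ) : ℤ),
      if 0 ≤ c - b then α (c - b).toNat b else 0 := by
  set s := Finset.Icc (-((n + 1 : ℕ) : ℤ)) ((n + 1 : ℕ) : ℤ) with hs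
  set t := Finset.Icc (n + 1 + 1) ((c + n + 1).toNat + 1) with ht
  have hterm : ∀ b ∈ s, (if 0 ≤ c - b then tildeCoeff (n + 1) α (c - b).toNat b else 0) =
      (if 0 ≤ c - b then α (c - b).toNat b else 0) -
        α (n + 1) ((n + 1 : ℕ) : ℤ) *
          (((if 0 ≤ c - b then IhalfCoeff (n + 1) (c - b).toNat b else 0 : ℤ)) :
            LaurentSeries ℤ) +
        ∑ a' ∈ t, α a' ((n + 1 : ℕ) : ℤ) *
          (((if 0 ≤ c - b then IshortCoeff (a' - 1) n (c - b).toNat b else 0 : ℤ)) :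
            LaurentSeries ℤ) := by
    intro b hb
    rw [hs, Finset.mem_Icc] at hb
    by_cases h : 0 ≤ c - b
    · simp only [if_pos h]
      exact tildeCoeff_eq_of_le (n + 1) α b (by omega)
    · simp only [if_neg h, Int.cast_zero, mul_zero, Finset.sum_const_zero, sub_zero, add_zero]
  rw [Finset.sum_congr rfl hterm, Finset.sum_add_distrib, Finset.sum_sub_distrib,
    Finset.sum_comm (s := s) (t := t), ← Finset.mul_sum, ← Int.cast_sum,
    sum_IhalfCoeff_diagonal (n + 1) hc]
  simp only [← Finset.mul_sum, ← Int.cast_sum]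
  simp only [hs, sum_IshortCoeff_diagonal, Int.cast_zero, mul_zero, Finset.sum_const_zero,
    sub_zero, add_zero]

/-- Inductive step of the `su(1|2)`-expansion theorem.  Let `m ≥ 1` and let
`p(τ,y) = Σ_{a≥0} Σ_{|b|≤m} α_{a,b} τ^a y^b` over `R = LaurentSeries ℤ` satisfy
conditions (1)–(4): `α_{a,b} = α_{a,-b}`; `α_{a,b} = 0` for `a < |b|`; `p(τ,τ)` is a
constant nonnegative integer; each `α_{a,-a}` (`a ≤ m`) is a nonnegative integer
multiple of `1`.  Set `q_a := α_{a,m}`.  Then `q_a = 0` for `a < m`, `q_m` is a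
nonnegative integer multiple of `1`, and
`p̃ := p - q_m I_{m,m} + Σ_{a≥m+1} q_a I_{a-1,m-1}` has `y`-degree at most `m-1` and
satisfies conditions (1)–(4) with `m` replaced by `m-1`. -/
theorem su12_expansion_inductive_step (m : ℕ) (hm : 1 ≤ m) (α : ℕ → ℤ → LaurentSeries ℤ)
    (hsupp : ∀ (a : ℕ) (b : ℤ), (m : ℤ) < |b| → α a b = 0)
    (h1 : ∀ (a : ℕ) (b : ℤ), α a b = α a (-b))
    (h2 : ∀ (a : ℕ) (b : ℤ), (a : ℤ) < |b| → α a b = 0)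
    (h3a : ∀ c : ℤ, 1 ≤ c →
      (∑ b ∈ Finset.Icc (-(m : ℤ)) (m : ℤ),
        if 0 ≤ c - b then α (c - b).toNat b else 0) = 0)
    (h3b : ∃ n : ℕ, (∑ b ∈ Finset.Icc (-(m : ℤ)) 0, α (-b).toNat b) = (n : LaurentSeries ℤ))
    (h4 : ∀ a : ℕ, a ≤ m → ∃ n : ℕ, α a (-(a : ℤ)) = (n : LaurentSeries ℤ)) :
    (∀ a : ℕ, a < m → α a m = 0) ∧
    (∃ n : ℕ, α m m = (n : LaurentSeries ℤ)) ∧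
    (∀ (a : ℕ) (b : ℤ), (m : ℤ) ≤ |b| → tildeCoeff m α a b = 0) ∧
    (∀ (a : ℕ) (b : ℤ), tildeCoeff m α a b = tildeCoeff m α a (-b)) ∧
    (∀ (a : ℕ) (b : ℤ), (a : ℤ) < |b| → tildeCoeff m α a b = 0) ∧
    (∀ c : ℤ, 1 ≤ c →
      (∑ b ∈ Finset.Icc (-((m : ℤ) - 1)) ((m : ℤ) - 1),
        if 0 ≤ c - b then tildeCoeff m α (c - b).toNat b else 0) = 0) ∧
    (∃ n : ℕ, (∑ b ∈ Finset.Icc (-((m : ℤ) - 1)) 0, tildeCoeff m α (-b).toNat b) =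
      (n : LaurentSeries ℤ)) ∧
    (∀ a : ℕ, a ≤ m - 1 → ∃ n : ℕ, tildeCoeff m α a (-(a : ℤ)) = (n : LaurentSeries ℤ)) := by
  obtain ⟨n, rfl⟩ : ∃ n, m = n + 1 := ⟨m - 1, by omega⟩
  have hlow : ∀ a : ℕ, a < n + 1 → α a ((n + 1 : ℕ) : ℤ) = 0 := fun a ha =>
    h2 a _ (by rw [Nat.abs_cast]; exact_mod_cast ha)
  have hdeg : ∀ (a : ℕ) (b : ℤ), ((n + 1 : ℕ) : ℤ) ≤ |b| → tildeCoeff (n + 1) α a b = 0 := by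
    intro a b hb
    rcases hb.lt_or_eq with hb | hb
    · exact tildeCoeff_eq_zero_of_lt_abs (hsupp a b hb) hb
    · rcases abs_choice b with h | h
      · rw [← h, ← hb]
        exact tildeCoeff_self (hlow a)
      · rw [tildeCoeff_neg h1, ← h, ← hb]
        exact tildeCoeff_self (hlow a)
  have hdiag : ∀ a : ℕ, a ≤ n →
      ∃ k : ℕ, tildeCoeff (n + 1) α a (-(a : ℤ)) = (k : LaurentSeries ℤ) := by
    intro a ha
    rw [tildeCoeff_of_lt α _ (by omega)]
    exact h4 a (by omega)
  refine ⟨hlow, ?_, hdeg, tildeCoeff_neg h1, ?_, ?_, ?_, hdiag⟩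
  · rw [h1]
    exact h4 (n + 1) le_rfl
  · intro a b hab
    rcases lt_or_ge a (n + 1) with h | h
    · rw [tildeCoeff_of_lt α b h, h2 a b hab]
    · exact hdeg a b (by omega)
  · intro c hc
    refine Eq.trans ?_ ((sum_tildeCoeff_diagonal n α hc).trans (h3a c hc))
    refine Finset.sum_subset (Finset.Icc_subset_Icc (by omega) (by omega)) fun b _ hb => ?_
    rw [Finset.mem_Icc] at hb
    rw [hdeg _ b (by rw [le_abs]; omega), ite_self]
  · refine exists_sum_eq_natCast _ _ fun b hb => ?_
    rw [Finset.mem_Icc] at hb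
    have hk := hdiag (-b).toNat (by omega)
    rwa [Int.toNat_of_nonneg (by omega), neg_neg] at hk
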